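/- Kripke completeness of Int2GC+FS: a formula A is provable in Int2GC+FS if and only if A is satisfied at every point of every Kripke model on every Int2GC+FS-frame. -/

import Mathlib

/-- Formulas of the modal language with four unary modalities:
`dia1` = ◆, `box1` = □, `dia2` = ◇, `box2` = ■. -/
inductive Fm : Type
  | var : ℕ → Fm
  | and : Fm → Fm → Fm
  | or  : Fm → Fm → Fm
  | imp : Fm → Fm → Fm
  | neg : Fm → Fm
  | dia1 : Fm → Fm
  | box1 : Fm → Fm
  | dia2 : Fm → Fm
  | box2 : Fm → Fm

/-- Instances of the axiom schemes of intuitionistic propositional logic. -/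
inductive IntAx : Fm → Prop
  | a1 (A B : Fm) : IntAx (.imp A (.imp B A))
  | a2 (A B C : Fm) : IntAx (.imp (.imp A (.imp B C)) (.imp (.imp A B) (.imp A C)))
  | a3 (A B : Fm) : IntAx (.imp (.and A B) A)
  | a4 (A B : Fm) : IntAx (.imp (.and A B) B)
  | a5 (A B : Fm) : IntAx (.imp A (.imp B (.and A B)))
  | a6 (A B : Fm) : IntAx (.imp A (.or A B))
  | a7 (A B : Fm) : IntAx (.imp B (.or A B))
  | a8 (A B C : Fm) : IntAx (.imp (.imp A C) (.imp (.imp B C) (.imp (.or A B) C)))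
  | a9 (A B : Fm) : IntAx (.imp (.imp A B) (.imp (.imp A (.neg B)) (.neg A)))
  | a10 (A B : Fm) : IntAx (.imp (.neg A) (.imp A B))

/-- Provability in the extension of Int2GC by the extra axiom scheme `Ax`:
the smallest set of formulas containing all intuitionistic axiom instances and all
instances of `Ax`, closed under modus ponens and the four Galois-connection rules. -/
inductive Prov (Ax : Fm → Prop) : Fm → Prop
  | intAx {A : Fm} : IntAx A → Prov Ax A
  | extra {A : Fm} : Ax A → Prov Ax A
  | mp {A B : Fm} : Prov Ax (.imp A B) → Prov Ax A → Prov Ax B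
  | gc1 {A B : Fm} : Prov Ax (.imp A (.box1 B)) → Prov Ax (.imp (.dia1 A) B)
  | gc2 {A B : Fm} : Prov Ax (.imp (.dia1 A) B) → Prov Ax (.imp A (.box1 B))
  | gc3 {A B : Fm} : Prov Ax (.imp A (.box2 B)) → Prov Ax (.imp (.dia2 A) B)
  | gc4 {A B : Fm} : Prov Ax (.imp (.dia2 A) B) → Prov Ax (.imp A (.box2 B))

/-- The empty extra axiom scheme: `Prov NoAx` is provability in Int2GC itself. -/
def NoAx : Fm → Prop := fun _ => False

/-- Instances of (FS1): ◆(A → B) → (■A → ◆B). -/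
def FS1Ax (C : Fm) : Prop := ∃ A B : Fm, C = .imp (.dia1 (.imp A B)) (.imp (.box2 A) (.dia1 B))
/-- Instances of (FS2): ◇(A → B) → (□A → ◇B). -/
def FS2Ax (C : Fm) : Prop := ∃ A B : Fm, C = .imp (.dia2 (.imp A B)) (.imp (.box1 A) (.dia2 B))
/-- Instances of (FS3): (◆A → ■B) → ■(A → B). -/
def FS3Ax (C : Fm) : Prop := ∃ A B : Fm, C = .imp (.imp (.dia1 A) (.box2 B)) (.box2 (.imp A B))
/-- Instances of (FS4): (◇A → □B) → □(A → B). -/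
def FS4Ax (C : Fm) : Prop := ∃ A B : Fm, C = .imp (.imp (.dia2 A) (.box1 B)) (.box1 (.imp A B))
/-- The Fischer Servi scheme (FS1)+(FS2); `Prov FSAx` is provability in Int2GC+FS. -/
def FSAx (C : Fm) : Prop := FS1Ax C ∨ FS2Ax C

/-- Satisfaction in a Kripke model on an Int2GC+FS-frame `(X, ≤, R)` with valuation `v`.
Here `x (R ∘ ≥) y` is rendered as `∃ z, R x z ∧ y ≤ z` and `x (≤ ∘ R) y` as
`∃ z, x ≤ z ∧ R z y`. -/
def SatFS {X : Type*} [Preorder X] (R : X → X → Prop) (v : ℕ → Set X) : X → Fm → Prop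
  | x, .var n => x ∈ v n
  | x, .and A B => SatFS R v x A ∧ SatFS R v x B
  | x, .or A B => SatFS R v x A ∨ SatFS R v x B
  | x, .imp A B => ∀ y, x ≤ y → SatFS R v y A → SatFS R v y B
  | x, .neg A => ∀ y, x ≤ y → ¬ SatFS R v y A
  | x, .dia1 A => ∃ y, (∃ z, R x z ∧ y ≤ z) ∧ SatFS R v y A
  | x, .box1 A => ∀ y, (∃ z, R y z ∧ x ≤ z) → SatFS R v y A
  | x, .dia2 A => ∃ y, (∃ z, y ≤ z ∧ R z x) ∧ SatFS R v y A
  | x, .box2 A => ∀ y, (∃ z, x ≤ z ∧ R z y) → SatFS R v y A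

namespace Prov

variable {Ax : Fm → Prop} {A B C D : Fm}

theorem imp_self (A : Fm) : Prov Ax (.imp A A) :=
  .mp (.mp (.intAx (.a2 A (.imp A A) A)) (.intAx (.a1 _ _))) (.intAx (.a1 _ _))

theorem weaken (h : Prov Ax B) : Prov Ax (.imp A B) := .mp (.intAx (.a1 _ _)) h

/-- Modus ponens under a hypothesis. -/
theorem mp_imp (h : Prov Ax (.imp C (.imp A B))) (h' : Prov Ax (.imp C A)) :
    Prov Ax (.imp C B) :=
  .mp (.mp (.intAx (.a2 _ _ _)) h) h'

theorem imp_trans (h : Prov Ax (.imp A B)) (h' : Prov Ax (.imp B C)) : Prov Ax (.imp A C) :=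
  mp_imp (weaken h') h

theorem and_left (A B : Fm) : Prov Ax (.imp (.and A B) A) := .intAx (.a3 _ _)

theorem and_right (A B : Fm) : Prov Ax (.imp (.and A B) B) := .intAx (.a4 _ _)

theorem imp_and (h : Prov Ax (.imp C A)) (h' : Prov Ax (.imp C B)) :
    Prov Ax (.imp C (.and A B)) :=
  mp_imp (imp_trans h (.intAx (.a5 _ _))) h'

theorem or_imp (h : Prov Ax (.imp A C)) (h' : Prov Ax (.imp B C)) :
    Prov Ax (.imp (.or A B) C) :=
  .mp (.mp (.intAx (.a8 _ _ _)) h) h'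

theorem curry_iff : Prov Ax (.imp A (.imp B C)) ↔ Prov Ax (.imp (.and A B) C) := by
  refine ⟨fun h => mp_imp (imp_trans (and_left _ _) h) (and_right _ _), fun h => ?_⟩
  have h₁ : Prov Ax (.imp A (.imp B (.and A B))) := .intAx (.a5 _ _)
  exact mp_imp (imp_trans (weaken (weaken h) : Prov Ax (.imp A _)) (.intAx (.a2 _ _ _))) h₁

theorem imp_imp_imp (h : Prov Ax (.imp B A)) (h' : Prov Ax (.imp C D)) :
    Prov Ax (.imp (.imp A C) (.imp B D)) :=
  curry_iff.2 (imp_trans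
    (mp_imp (and_left _ _) (imp_trans (and_right _ _) h)) h')

theorem neg_imp_neg (h : Prov Ax (.imp B A)) : Prov Ax (.imp (.neg A) (.neg B)) := by
  have h₁ : Prov Ax (.imp (.neg A) (.imp B (.neg B))) :=
    imp_trans (.intAx (.a10 A (.neg B))) (imp_imp_imp h (imp_self _))
  exact mp_imp (mp_imp (weaken (.intAx (.a9 B B))) (weaken (imp_self _))) h₁

theorem absurd_imp (A B : Fm) : Prov Ax (.imp (.and A (.neg A)) B) :=
  mp_imp (imp_trans (and_right _ _) (.intAx (.a10 _ _))) (and_left _ _)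

theorem imp_absurd (A B : Fm) :
    Prov Ax (.imp (.imp A (.and B (.neg B))) (.neg A)) :=
  mp_imp (imp_trans (imp_imp_imp (imp_self _) (absurd_imp _ _)) (.intAx (.a9 A A)))
    (imp_imp_imp (imp_self _) (absurd_imp _ _))

theorem dia1_mono (h : Prov Ax (.imp A B)) : Prov Ax (.imp (.dia1 A) (.dia1 B)) :=
  .gc1 (imp_trans h (.gc2 (imp_self _)))

theorem box1_mono (h : Prov Ax (.imp A B)) : Prov Ax (.imp (.box1 A) (.box1 B)) :=
  .gc2 (imp_trans (.gc1 (imp_self _)) h)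

theorem dia2_mono (h : Prov Ax (.imp A B)) : Prov Ax (.imp (.dia2 A) (.dia2 B)) :=
  .gc3 (imp_trans h (.gc4 (imp_self _)))

theorem box2_mono (h : Prov Ax (.imp A B)) : Prov Ax (.imp (.box2 A) (.box2 B)) :=
  .gc4 (imp_trans (.gc3 (imp_self _)) h)

end Prov

/-- Interderivability in the logic with extra axioms `Ax`. -/
def Prov.setoid (Ax : Fm → Prop) : Setoid Fm where
  r A B := Prov Ax (.imp A B) ∧ Prov Ax (.imp B A)
  iseqv := ⟨fun A => ⟨.imp_self A, .imp_self A⟩, fun h => ⟨h.2, h.1⟩,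
    fun h h' => ⟨h.1.imp_trans h'.1, h'.2.imp_trans h.2⟩⟩

/-- The Lindenbaum algebra of the logic with extra axioms `Ax`. -/
def Lindenbaum (Ax : Fm → Prop) : Type := Quotient (Prov.setoid Ax)

namespace Lindenbaum

variable {Ax : Fm → Prop}

/-- The class of a formula. -/
def mk (A : Fm) : Lindenbaum Ax := Quotient.mk (Prov.setoid Ax) A

theorem forall_mk {p : Lindenbaum Ax → Prop} (h : ∀ A, p (mk A)) (a : Lindenbaum Ax) : p a :=
  Quotient.ind h a

/-- The operation on classes induced by a monotone unary connective. -/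
def map (f : Fm → Fm)
    (hf : ∀ {A B}, Prov Ax (.imp A B) → Prov Ax (.imp (f A) (f B))) :
    Lindenbaum Ax → Lindenbaum Ax :=
  Quotient.map f fun _ _ h => ⟨hf h.1, hf h.2⟩

instance : PartialOrder (Lindenbaum Ax) where
  le := Quotient.lift₂ (fun A B => Prov Ax (.imp A B)) fun _ _ _ _ h h' =>
    propext ⟨fun k => (h.2.imp_trans k).imp_trans h'.1, fun k => (h.1.imp_trans k).imp_trans h'.2⟩
  le_refl := forall_mk Prov.imp_self
  le_trans := forall_mk fun _ => forall_mk fun _ => forall_mk fun _ => Prov.imp_trans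
  le_antisymm := forall_mk fun _ => forall_mk fun _ h h' => Quotient.sound ⟨h, h'⟩

theorem mk_le_mk {A B : Fm} : (mk A : Lindenbaum Ax) ≤ mk B ↔ Prov Ax (.imp A B) := Iff.rfl

instance : HeytingAlgebra (Lindenbaum Ax) where
  sup := Quotient.map₂ .or fun _ _ h _ _ h' =>
    ⟨.or_imp (h.1.imp_trans (.intAx (.a6 _ _))) (h'.1.imp_trans (.intAx (.a7 _ _))),
      .or_imp (h.2.imp_trans (.intAx (.a6 _ _))) (h'.2.imp_trans (.intAx (.a7 _ _)))⟩
  inf := Quotient.map₂ .and fun _ _ h _ _ h' =>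
    ⟨.imp_and ((Prov.and_left _ _).imp_trans h.1) ((Prov.and_right _ _).imp_trans h'.1),
      .imp_and ((Prov.and_left _ _).imp_trans h.2) ((Prov.and_right _ _).imp_trans h'.2)⟩
  himp := Quotient.map₂ .imp fun _ _ h _ _ h' =>
    ⟨.imp_imp_imp h.2 h'.1, .imp_imp_imp h.1 h'.2⟩
  compl := Quotient.map .neg fun _ _ h => ⟨.neg_imp_neg h.2, .neg_imp_neg h.1⟩
  top := mk (.imp (.var 0) (.var 0))
  bot := mk (.and (.var 0) (.neg (.var 0)))
  le_sup_left := forall_mk fun _ => forall_mk fun _ => Prov.intAx (.a6 _ _)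
  le_sup_right := forall_mk fun _ => forall_mk fun _ => Prov.intAx (.a7 _ _)
  sup_le := forall_mk fun _ => forall_mk fun _ => forall_mk fun _ => Prov.or_imp
  inf_le_left := forall_mk fun _ => forall_mk fun _ => Prov.and_left _ _
  inf_le_right := forall_mk fun _ => forall_mk fun _ => Prov.and_right _ _
  le_inf := forall_mk fun _ => forall_mk fun _ => forall_mk fun _ => Prov.imp_and
  le_top := forall_mk fun _ => Prov.weaken (Prov.imp_self _)
  bot_le := forall_mk fun _ => Prov.absurd_imp _ _
  le_himp_iff := forall_mk fun _ => forall_mk fun _ => forall_mk fun _ => Prov.curry_iff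
  himp_bot := forall_mk fun _ => le_antisymm (mk_le_mk.2 (Prov.imp_absurd _ _))
    (mk_le_mk.2 (.intAx (.a10 _ _)))

theorem mk_and (A B : Fm) : (mk (.and A B) : Lindenbaum Ax) = mk A ⊓ mk B := rfl

theorem mk_or (A B : Fm) : (mk (.or A B) : Lindenbaum Ax) = mk A ⊔ mk B := rfl

theorem mk_imp (A B : Fm) : (mk (.imp A B) : Lindenbaum Ax) = mk A ⇨ mk B := rfl

theorem mk_neg (A : Fm) : (mk (.neg A) : Lindenbaum Ax) = (mk A)ᶜ := rfl

theorem mk_eq_top {A : Fm} : (mk A : Lindenbaum Ax) = ⊤ ↔ Prov Ax A :=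
  ⟨fun h => .mp (mk_le_mk.1 h.ge) (Prov.imp_self _), fun h => top_le_iff.1 (mk_le_mk.2 h.weaken)⟩

/-- The operation ◆ on the Lindenbaum algebra. -/
def dia1 : Lindenbaum Ax → Lindenbaum Ax := map .dia1 Prov.dia1_mono

/-- The operation □ on the Lindenbaum algebra. -/
def box1 : Lindenbaum Ax → Lindenbaum Ax := map .box1 Prov.box1_mono

/-- The operation ◇ on the Lindenbaum algebra. -/
def dia2 : Lindenbaum Ax → Lindenbaum Ax := map .dia2 Prov.dia2_mono

/-- The operation ■ on the Lindenbaum algebra. -/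
def box2 : Lindenbaum Ax → Lindenbaum Ax := map .box2 Prov.box2_mono

theorem gc_dia1_box1 : GaloisConnection (dia1 (Ax := Ax)) box1 :=
  forall_mk fun _ => forall_mk fun _ => ⟨Prov.gc2, Prov.gc1⟩

theorem gc_dia2_box2 : GaloisConnection (dia2 (Ax := Ax)) box2 :=
  forall_mk fun _ => forall_mk fun _ => ⟨Prov.gc4, Prov.gc3⟩

theorem dia1_himp_le : ∀ a b : Lindenbaum FSAx, dia1 (a ⇨ b) ≤ box2 a ⇨ dia1 b :=
  forall_mk fun A => forall_mk fun B => Prov.extra (Or.inl ⟨A, B, rfl⟩)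

theorem dia2_himp_le : ∀ a b : Lindenbaum FSAx, dia2 (a ⇨ b) ≤ box1 a ⇨ dia2 b :=
  forall_mk fun A => forall_mk fun B => Prov.extra (Or.inr ⟨A, B, rfl⟩)

end Lindenbaum

/-- Prime filters of a bounded lattice. -/
@[ext]
structure PrimeFilter (H : Type*) [Lattice H] [BoundedOrder H] where
  /-- The elements of the filter. -/
  carrier : Set H
  top_mem : ⊤ ∈ carrier
  bot_notMem : ⊥ ∉ carrier
  inf_mem {a b : H} : a ∈ carrier → b ∈ carrier → a ⊓ b ∈ carrier
  mem_of_le {a b : H} : a ≤ b → a ∈ carrier → b ∈ carrier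
  mem_or_mem {a b : H} : a ⊔ b ∈ carrier → a ∈ carrier ∨ b ∈ carrier

namespace PrimeFilter

instance {H : Type*} [Lattice H] [BoundedOrder H] : SetLike (PrimeFilter H) H where
  coe := carrier
  coe_injective _ _ := PrimeFilter.ext

instance {H : Type*} [Lattice H] [BoundedOrder H] : PartialOrder (PrimeFilter H) :=
  .ofSetLike (PrimeFilter H) H

section Lattice

variable {H : Type*} [DistribLattice H] [BoundedOrder H] {x : PrimeFilter H} {a b : H}

theorem mem_mono (h : a ≤ b) (ha : a ∈ x) : b ∈ x := x.mem_of_le h ha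

theorem inf_mem_iff : a ⊓ b ∈ x ↔ a ∈ x ∧ b ∈ x :=
  ⟨fun h => ⟨mem_mono inf_le_left h, mem_mono inf_le_right h⟩, fun h => x.inf_mem h.1 h.2⟩

theorem sup_mem_iff : a ⊔ b ∈ x ↔ a ∈ x ∨ b ∈ x :=
  ⟨x.mem_or_mem, fun h => h.elim (mem_mono le_sup_left) (mem_mono le_sup_right)⟩

/-- The prime filter theorem, for a filter base `F` and an ideal base `I`. -/
theorem exists_separating {F I : Set H} (hF : F.Nonempty) (hI : I.Nonempty)
    (hF' : ∀ a ∈ F, ∀ b ∈ F, a ⊓ b ∈ F) (hI' : ∀ a ∈ I, ∀ b ∈ I, ∃ c ∈ I, a ⊔ b ≤ c)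
    (h : ∀ a ∈ F, ∀ b ∈ I, ¬ a ≤ b) :
    ∃ x : PrimeFilter H, (∀ a ∈ F, a ∈ x) ∧ ∀ a ∈ I, a ∉ x := by
  have hF₁ : Order.IsPFilter {b | ∃ a ∈ F, a ≤ b} := by
    refine Order.IsPFilter.of_def (hF.imp fun a ha => ⟨a, ha, le_rfl⟩) ?_ ?_
    · rintro b ⟨a, ha, hab⟩ b' ⟨a', ha', hab'⟩
      exact ⟨a ⊓ a', ⟨_, hF' a ha a' ha', le_rfl⟩, inf_le_left.trans hab, inf_le_right.trans hab'⟩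
    · rintro b b' hb ⟨a, ha, hab⟩
      exact ⟨a, ha, hab.trans hb⟩
  have hI₁ : Order.IsIdeal {b | ∃ a ∈ I, b ≤ a} := by
    refine ⟨?_, hI.imp fun a ha => ⟨a, ha, le_rfl⟩, ?_⟩
    · rintro b b' hb ⟨a, ha, hab⟩
      exact ⟨a, ha, hb.trans hab⟩
    · rintro b ⟨a, ha, hab⟩ b' ⟨a', ha', hab'⟩
      obtain ⟨c, hc, hac⟩ := hI' a ha a' ha'
      exact ⟨c, ⟨c, hc, le_rfl⟩, hab.trans (le_sup_left.trans hac),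
        hab'.trans (le_sup_right.trans hac)⟩
  obtain ⟨J, hJ, hIJ, hFJ⟩ := DistribLattice.prime_ideal_of_disjoint_filter_ideal
    (F := hF₁.toPFilter) (I := hI₁.toIdeal) (by
      rw [Set.disjoint_left]
      rintro c ⟨a, ha, hac⟩ ⟨b, hb, hcb⟩
      exact h a ha b hb (hac.trans hcb))
  refine ⟨⟨{a | a ∉ J}, hJ.top_notMem, fun h => h J.bot_mem, fun ha hb hab =>
    (hJ.mem_or_mem hab).elim ha hb, fun hab ha hb => ha (J.lower hab hb), ?_⟩, ?_, ?_⟩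
  · intro a b hab
    by_contra! hn
    exact hab (Order.Ideal.sup_mem (not_not.1 hn.1) (not_not.1 hn.2))
  · exact fun a ha haJ => Set.disjoint_left.1 hFJ ⟨a, ha, le_rfl⟩ haJ
  · exact fun a ha haJ => haJ (hIJ ⟨a, ha, le_rfl⟩)

end Lattice

section Heyting

variable {H : Type*} [HeytingAlgebra H] {x y : PrimeFilter H} {a b : H}

theorem mem_of_himp_mem (h : a ⇨ b ∈ x) (ha : a ∈ x) : b ∈ x :=
  mem_mono himp_inf_le (inf_mem_iff.2 ⟨h, ha⟩)

theorem himp_mem_iff : a ⇨ b ∈ x ↔ ∀ y, x ≤ y → a ∈ y → b ∈ y := by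
  refine ⟨fun h y hxy ha => mem_of_himp_mem (hxy h) ha, fun h => ?_⟩
  by_contra hn
  obtain ⟨y, hy, hb⟩ := exists_separating (F := {c | ∃ u ∈ x, c = u ⊓ a}) (I := {b})
    ⟨_, ⊤, x.top_mem, rfl⟩ ⟨b, rfl⟩
    (by
      rintro _ ⟨u, hu, rfl⟩ _ ⟨v, hv, rfl⟩
      exact ⟨u ⊓ v, x.inf_mem hu hv, (inf_inf_distrib_right u v a).symm⟩)
    (by rintro _ rfl _ rfl; exact ⟨_, rfl, (sup_idem _).le⟩)
    (by
      rintro _ ⟨u, hu, rfl⟩ _ rfl hle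
      exact hn (mem_mono (le_himp_iff.2 hle) hu))
  exact hb b rfl (h y (fun u hu => mem_mono inf_le_left (hy _ ⟨u, hu, rfl⟩))
    (mem_mono inf_le_right (hy _ ⟨⊤, x.top_mem, rfl⟩)))

theorem compl_mem_iff : aᶜ ∈ x ↔ ∀ y, x ≤ y → a ∉ y := by
  rw [← himp_bot, himp_mem_iff]
  exact forall₃_congr fun y _ _ => iff_of_false y.bot_notMem not_false

/-- The canonical accessibility relation of a diamond `d` and a box `b`. -/
def Rel (d b : H → H) (x y : PrimeFilter H) : Prop :=
  (∀ a, b a ∈ x → a ∈ y) ∧ ∀ a, a ∈ y → d a ∈ x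

end Heyting

end PrimeFilter

/-- A Heyting algebra with two Galois connections `d₁ ⊣ b₁` and `d₂ ⊣ b₂` linked by the
Fischer Servi inequalities. -/
structure FischerServi {H : Type*} [HeytingAlgebra H] (d₁ b₁ d₂ b₂ : H → H) : Prop where
  gc₁ : GaloisConnection d₁ b₁
  gc₂ : GaloisConnection d₂ b₂
  himp_le₁ : ∀ a b, d₁ (a ⇨ b) ≤ b₂ a ⇨ d₁ b
  himp_le₂ : ∀ a b, d₂ (a ⇨ b) ≤ b₁ a ⇨ d₂ b

namespace FischerServi

open PrimeFilter

variable {H : Type*} [HeytingAlgebra H] {d₁ b₁ d₂ b₂ : H → H} {x y : PrimeFilter H} {a : H}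

theorem symm (h : FischerServi d₁ b₁ d₂ b₂) : FischerServi d₂ b₂ d₁ b₁ :=
  ⟨h.gc₂, h.gc₁, h.himp_le₂, h.himp_le₁⟩

theorem inf_le (h : FischerServi d₁ b₁ d₂ b₂) (a b : H) : d₁ a ⊓ b₂ b ≤ d₁ (b ⊓ a) := by
  rw [← le_himp_iff]
  exact (h.gc₁.monotone_l (le_himp_iff.2 (inf_comm a b).le)).trans (h.himp_le₁ _ _)

theorem himp_le_box (h : FischerServi d₁ b₁ d₂ b₂) (a b : H) : d₁ a ⇨ b₂ b ≤ b₂ (a ⇨ b) := by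
  refine h.gc₂.le_u ((h.himp_le₂ _ _).trans ?_)
  exact himp_le_himp (h.gc₁.le_u_l a) (h.gc₂.l_u_le b)

theorem rel_swap (h : FischerServi d₁ b₁ d₂ b₂) (hxy : Rel d₁ b₂ x y) : Rel d₂ b₁ y x :=
  ⟨fun a ha => mem_mono (h.gc₁.l_u_le a) (hxy.2 _ ha),
    fun a ha => hxy.1 _ (mem_mono (h.gc₂.le_u_l a) ha)⟩

theorem exists_rel_of_dia_mem (h : FischerServi d₁ b₁ d₂ b₂) (ha : d₁ a ∈ x) :
    ∃ y, Rel d₁ b₂ x y ∧ a ∈ y := by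
  obtain ⟨y, hF, hI⟩ := exists_separating (F := {c | ∃ u, b₂ u ∈ x ∧ c = u ⊓ a})
    (I := {c | d₁ c ∉ x})
    ⟨_, ⊤, by rw [h.gc₂.u_top]; exact x.top_mem, rfl⟩
    ⟨⊥, by rw [Set.mem_ofPred_eq, h.gc₁.l_bot]; exact x.bot_notMem⟩
    (by
      rintro _ ⟨u, hu, rfl⟩ _ ⟨v, hv, rfl⟩
      exact ⟨u ⊓ v, by rw [h.gc₂.u_inf]; exact x.inf_mem hu hv,
        (inf_inf_distrib_right u v a).symm⟩)
    (fun c hc e he => ⟨c ⊔ e, by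
      rw [Set.mem_ofPred_eq, h.gc₁.l_sup, sup_mem_iff]; exact not_or.2 ⟨hc, he⟩, le_rfl⟩)
    (by
      rintro _ ⟨u, hu, rfl⟩ c hc hle
      exact hc (mem_mono ((h.inf_le a u).trans (h.gc₁.monotone_l hle)) (x.inf_mem ha hu)))
  refine ⟨y, ⟨fun u hu => mem_mono inf_le_left (hF _ ⟨u, hu, rfl⟩), fun c hc => ?_⟩,
    mem_mono inf_le_right (hF _ ⟨⊤, by rw [h.gc₂.u_top]; exact x.top_mem, rfl⟩)⟩
  by_contra hn
  exact hI c hn hc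

theorem exists_le_rel (h : FischerServi d₁ b₁ d₂ b₂) (hxy : ∀ a, b₂ a ∈ x → a ∈ y) :
    ∃ w, x ≤ w ∧ Rel d₁ b₂ w y := by
  obtain ⟨w, hF, hI⟩ := exists_separating
    (F := {e | ∃ u ∈ x, ∃ c ∈ y, u ⊓ d₁ c ≤ e}) (I := {e | ∃ c, c ∉ y ∧ e = b₂ c})
    ⟨_, ⊤, x.top_mem, ⊤, y.top_mem, le_rfl⟩ ⟨_, ⊥, y.bot_notMem, rfl⟩
    (by
      rintro e ⟨u, hu, c, hc, he⟩ e' ⟨u', hu', c', hc', he'⟩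
      refine ⟨u ⊓ u', x.inf_mem hu hu', c ⊓ c', y.inf_mem hc hc', le_inf ?_ ?_⟩
      · exact (inf_le_inf inf_le_left (h.gc₁.monotone_l inf_le_left)).trans he
      · exact (inf_le_inf inf_le_right (h.gc₁.monotone_l inf_le_right)).trans he')
    (by
      rintro _ ⟨c, hc, rfl⟩ _ ⟨c', hc', rfl⟩
      exact ⟨_, ⟨c ⊔ c', fun hn => (y.mem_or_mem hn).elim hc hc', rfl⟩,
        h.gc₂.monotone_u.le_map_sup c c'⟩)
    (by
      rintro e ⟨u, hu, c, hc, he⟩ _ ⟨c', hc', rfl⟩ hle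
      have hu' : u ≤ b₂ (c ⇨ c') := (le_himp_iff.2 (he.trans hle)).trans (h.himp_le_box c c')
      exact hc' (mem_of_himp_mem (hxy _ (mem_mono hu' hu)) hc))
  refine ⟨w, fun u hu => hF _ ⟨u, hu, ⊤, y.top_mem, inf_le_left⟩, fun c hc => ?_,
    fun c hc => hF _ ⟨⊤, x.top_mem, c, hc, inf_le_right⟩⟩
  by_contra hn
  exact hI _ ⟨c, hn, rfl⟩ hc

theorem exists_le_rel_of_rel_of_le (h : FischerServi d₁ b₁ d₂ b₂) (hxy : Rel d₁ b₂ x y)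
    {z : PrimeFilter H} (hyz : y ≤ z) : ∃ w, x ≤ w ∧ Rel d₁ b₂ w z :=
  h.exists_le_rel fun a ha => hyz (hxy.1 a ha)

theorem dia_mem_iff (h : FischerServi d₁ b₁ d₂ b₂) :
    d₁ a ∈ x ↔ ∃ y, (∃ z, Rel d₁ b₂ x z ∧ y ≤ z) ∧ a ∈ y := by
  refine ⟨fun ha => ?_, fun ⟨y, ⟨z, hz, hyz⟩, ha⟩ => hz.2 a (hyz ha)⟩
  obtain ⟨y, hy, ha⟩ := h.exists_rel_of_dia_mem ha
  exact ⟨y, ⟨y, hy, le_rfl⟩, ha⟩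

theorem box_mem_iff (h : FischerServi d₁ b₁ d₂ b₂) :
    b₂ a ∈ x ↔ ∀ y, (∃ z, x ≤ z ∧ Rel d₁ b₂ z y) → a ∈ y := by
  refine ⟨fun ha y ⟨z, hxz, hz⟩ => hz.1 a (hxz ha), fun hall => ?_⟩
  by_contra hn
  obtain ⟨y, hF, hI⟩ := exists_separating (F := {c | b₂ c ∈ x}) (I := {a})
    ⟨⊤, by rw [Set.mem_ofPred_eq, h.gc₂.u_top]; exact x.top_mem⟩ ⟨a, rfl⟩
    (fun c hc e he => by rw [Set.mem_ofPred_eq, h.gc₂.u_inf]; exact x.inf_mem hc he)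
    (by rintro _ rfl _ rfl; exact ⟨_, rfl, (sup_idem _).le⟩)
    (by rintro c hc _ rfl hle; exact hn (mem_mono (h.gc₂.monotone_u hle) hc))
  exact hI a rfl (hall y (h.exists_le_rel hF))

end FischerServi

section Soundness

variable {X : Type*} [Preorder X] {R : X → X → Prop} {v : ℕ → Set X}

theorem SatFS.mono (h₁ : ∀ x y z : X, R x y → y ≤ z → ∃ w, x ≤ w ∧ R w z)
    (h₂ : ∀ x y z : X, y ≤ x → R y z → ∃ w, R x w ∧ z ≤ w) (hv : ∀ n, IsUpperSet (v n)) {A : Fm}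
    {x y : X} (hxy : x ≤ y) (h : SatFS R v x A) : SatFS R v y A := by
  induction A generalizing x y with
  | var n => exact hv n hxy h
  | and A B ihA ihB => exact ⟨ihA hxy h.1, ihB hxy h.2⟩
  | or A B ihA ihB => exact h.imp (ihA hxy) (ihB hxy)
  | imp A B => exact fun z hz => h z (hxy.trans hz)
  | neg A => exact fun z hz => h z (hxy.trans hz)
  | dia1 A ih =>
    obtain ⟨u, ⟨z, hxz, huz⟩, hu⟩ := h
    obtain ⟨w, hyw, hzw⟩ := h₂ _ _ _ hxy hxz
    exact ⟨u, ⟨w, hyw, huz.trans hzw⟩, hu⟩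
  | box1 A => exact fun u ⟨z, huz, hyz⟩ => h u ⟨z, huz, hxy.trans hyz⟩
  | dia2 A ih =>
    obtain ⟨u, ⟨z, huz, hzx⟩, hu⟩ := h
    obtain ⟨w, hzw, hwy⟩ := h₁ _ _ _ hzx hxy
    exact ⟨u, ⟨w, huz.trans hzw, hwy⟩, hu⟩
  | box2 A => exact fun u ⟨z, hyz, hzu⟩ => h u ⟨z, hxy.trans hyz, hzu⟩

theorem Prov.satFS (h₁ : ∀ x y z : X, R x y → y ≤ z → ∃ w, x ≤ w ∧ R w z)
    (h₂ : ∀ x y z : X, y ≤ x → R y z → ∃ w, R x w ∧ z ≤ w) (hv : ∀ n, IsUpperSet (v n)) {A : Fm}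
    (h : Prov FSAx A) (x : X) : SatFS R v x A := by
  have mono {A : Fm} {x y : X} (hxy : x ≤ y) (h : SatFS R v x A) : SatFS R v y A :=
    h.mono h₁ h₂ hv hxy
  induction h generalizing x with
  | intAx h =>
    cases h with
    | a1 A B => exact fun y _ hA z hyz _ => mono hyz hA
    | a2 A B C =>
      exact fun _ _ hABC z hz hAB u hu hA =>
        hABC u (hz.trans hu) hA u le_rfl (hAB u hu hA)
    | a3 A B => exact fun _ _ h => h.1
    | a4 A B => exact fun _ _ h => h.2
    | a5 A B => exact fun _ _ hA _ hz hB => ⟨mono hz hA, hB⟩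
    | a6 A B => exact fun _ _ h => Or.inl h
    | a7 A B => exact fun _ _ h => Or.inr h
    | a8 A B C => exact fun _ _ hA z hz hB u hu h => h.elim (hA u (hz.trans hu)) (hB u hu)
    | a9 A B =>
      exact fun _ _ hB z hz hn u hu hA => hn u hu hA u le_rfl (hB u (hz.trans hu) hA)
    | a10 A B => exact fun _ _ hn z hz hA => absurd hA (hn z hz)
  | extra h =>
    obtain ⟨A, B, rfl⟩ | ⟨A, B, rfl⟩ := h
    · rintro y - h z hyz hA
      obtain ⟨u, ⟨w, hzw, huw⟩, hu⟩ := mono hyz h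
      exact ⟨w, ⟨w, hzw, le_rfl⟩, hu w huw (hA w ⟨z, le_rfl, hzw⟩)⟩
    · rintro y - h z hyz hA
      obtain ⟨u, ⟨w, huw, hwz⟩, hu⟩ := mono hyz h
      exact ⟨w, ⟨w, le_rfl, hwz⟩, hu w huw (hA w ⟨z, hwz, le_rfl⟩)⟩
  | mp _ _ ih ih' => exact ih x x le_rfl (ih' x)
  | gc1 _ ih =>
    rintro y - ⟨u, ⟨z, hyz, huz⟩, hu⟩
    exact ih u z huz (mono huz hu) y ⟨z, hyz, le_rfl⟩
  | gc2 _ ih =>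
    rintro y - hA u ⟨z, huz, hyz⟩
    exact ih u u le_rfl ⟨y, ⟨z, huz, hyz⟩, hA⟩
  | gc3 _ ih =>
    rintro y - ⟨u, ⟨z, huz, hzy⟩, hu⟩
    exact ih u z huz (mono huz hu) y ⟨z, le_rfl, hzy⟩
  | gc4 _ ih =>
    rintro y - hA u ⟨z, hyz, hzu⟩
    exact ih u u le_rfl ⟨y, ⟨z, hyz, hzu⟩, hA⟩

end Soundness

namespace Lindenbaum

open PrimeFilter

theorem fischerServi : FischerServi (dia1 (Ax := FSAx)) box1 dia2 box2 :=
  ⟨gc_dia1_box1, gc_dia2_box2, dia1_himp_le, dia2_himp_le⟩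

theorem rel_swap_iff {x y : PrimeFilter (Lindenbaum FSAx)} :
    Rel dia2 box1 x y ↔ Rel dia1 box2 y x :=
  ⟨fischerServi.symm.rel_swap, fischerServi.rel_swap⟩

/-- The truth lemma for the canonical model. -/
theorem satFS_iff {A : Fm} {x : PrimeFilter (Lindenbaum FSAx)} :
    SatFS (Rel dia1 box2) (fun n => {y | mk (.var n) ∈ y}) x A ↔ mk A ∈ x := by
  induction A generalizing x with
  | var n => exact Iff.rfl
  | and A B ihA ihB => rw [mk_and, inf_mem_iff, ← ihA, ← ihB]; rfl
  | or A B ihA ihB => rw [mk_or, sup_mem_iff, ← ihA, ← ihB]; rfl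
  | imp A B ihA ihB =>
    rw [mk_imp, himp_mem_iff]
    exact forall₂_congr fun y _ => imp_congr ihA ihB
  | neg A ih =>
    rw [mk_neg, compl_mem_iff]
    exact forall₂_congr fun y _ => not_congr ih
  | dia1 A ih =>
    refine Iff.trans ?_ (fischerServi.dia_mem_iff (a := mk A)).symm
    exact exists_congr fun y => and_congr_right' ih
  | box1 A ih =>
    refine Iff.trans ?_ (fischerServi.symm.box_mem_iff (a := mk A)).symm
    exact forall_congr' fun y => imp_congr
      (exists_congr fun z => and_comm.trans (and_congr_right' rel_swap_iff.symm)) ih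
  | dia2 A ih =>
    refine Iff.trans ?_ (fischerServi.symm.dia_mem_iff (a := mk A)).symm
    exact exists_congr fun y => and_congr
      (exists_congr fun z => and_comm.trans (and_congr_left' rel_swap_iff.symm)) ih
  | box2 A ih =>
    refine Iff.trans ?_ (fischerServi.box_mem_iff (a := mk A)).symm
    exact forall_congr' fun y => imp_congr_right fun _ => ih

end Lindenbaum

/-- Kripke completeness of Int2GC+FS: a formula is provable in Int2GC+FS iff it is
satisfied at every point of every Kripke model on every Int2GC+FS-frame. -/
theorem int2gcfs_kripke_complete (A : Fm) :
    Prov FSAx A ↔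
      ∀ (X : Type) [Preorder X] (R : X → X → Prop),
        (∀ x y z : X, R x y → y ≤ z → ∃ w, x ≤ w ∧ R w z) →
        (∀ x y z : X, y ≤ x → R y z → ∃ w, R x w ∧ z ≤ w) →
        ∀ v : ℕ → Set X, (∀ n, IsUpperSet (v n)) →
        ∀ x : X, SatFS R v x A := by
  refine ⟨fun h X _ R h₁ h₂ v hv x => h.satFS h₁ h₂ hv x, fun h => ?_⟩
  by_contra hn
  obtain ⟨x, -, hx⟩ := PrimeFilter.exists_separating (F := {⊤})
    (I := {(Lindenbaum.mk A : Lindenbaum FSAx)}) ⟨⊤, rfl⟩ ⟨_, rfl⟩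
    (by rintro _ rfl _ rfl; exact inf_idem _)
    (by rintro _ rfl _ rfl; exact ⟨_, rfl, (sup_idem _).le⟩)
    (by rintro _ rfl _ rfl hle; exact hn (Lindenbaum.mk_eq_top.1 (top_le_iff.1 hle)))
  have hv (n : ℕ) : IsUpperSet {y : PrimeFilter (Lindenbaum FSAx) | Lindenbaum.mk (.var n) ∈ y} :=
    fun _ _ hyz hy => hyz hy
  refine hx _ rfl (Lindenbaum.satFS_iff.1 (h _ _ ?_ ?_ _ hv x))
  · exact fun x y z hxy hyz => Lindenbaum.fischerServi.exists_le_rel_of_rel_of_le hxy hyz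
  · intro x y z hyx hyz
    obtain ⟨w, hzw, hw⟩ := Lindenbaum.fischerServi.symm.exists_le_rel_of_rel_of_le
      (Lindenbaum.fischerServi.rel_swap hyz) hyx
    exact ⟨w, Lindenbaum.rel_swap_iff.1 hw, hzw⟩
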